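/- Let P be a poset with an order-reversing involution satisfying the geometric axioms GA0–GA3. Then for every p ∈ P there exists a splitting (r, s) of p admitting a reflection: there exist a splitting (a, b) of p' and an element c ∈ P with r ≤ c, a ≤ c, s ≤ c', and b ≤ c'. -/

import Mathlib

/-- An element `x` is `q`-small. -/
def QSmall {P : Type*} [PartialOrder P] (i : P → P) (q x : P) : Prop :=
  ∃ r s : P, x ≤ r ∧ q ≤ r ∧ x ≤ s ∧ i q ≤ s

/-- An element `x` is a `q`-indicator. -/
def QInd {P : Type*} [PartialOrder P] (i : P → P) (q x : P) : Prop :=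
  x ≤ q ∨ x ≤ i q

/-- Given GA0–GA3, every `p` has a splitting `(r, s)` admitting a reflection:
a splitting `(a, b)` of `p'` and a `c` with `r, a ≤ c` and `s, b ≤ c'`. -/
theorem splitting_admitting_reflection_exists
    {P : Type*} [PartialOrder P] (i : P → P)
    (hanti : ∀ p q : P, p ≤ q → i q ≤ i p) (hinv : ∀ p : P, i (i p) = p)
    (GA0 : ∀ p : P, ¬ ∃ r : P, r ≤ p ∧ r ≤ i p)
    (GA1 : ∀ p q : P, (∃ r, r ≤ p ∧ r ≤ q) ∨ (∃ r, r ≤ p ∧ r ≤ i q))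
    (GA2 : ∀ p : P, ∃ r s, r ≤ p ∧ s ≤ p ∧ r ≤ i s)
    (GA3 : ∀ p q pt ph : P, pt ≤ p → QSmall i q pt → QInd i q pt →
      ph ≤ p → QSmall i q ph → QInd i q ph →
      ∃ (n : ℕ) (z : Fin (n + 1) → P) (y : Fin n → P),
        z 0 = pt ∧ z (Fin.last n) = ph ∧
        (∀ j : Fin n, z j.castSucc ≤ y j ∧ z j.succ ≤ y j) ∧
        (∀ j : Fin (n + 1), z j ≤ p) ∧ (∀ j : Fin n, y j ≤ p) ∧
        (∀ j : Fin (n + 1), QInd i q (z j)) ∧ (∀ j : Fin n, QSmall i q (y j)))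
    (p : P) :
    ∃ r s a b c : P,
      r ≤ p ∧ s ≤ p ∧ r ≤ i s ∧
      a ≤ i p ∧ b ≤ i p ∧ a ≤ i b ∧
      r ≤ c ∧ a ≤ c ∧ s ≤ i c ∧ b ≤ i c := by
  by_contra hno
  obtain ⟨r, s, hr, hs, hrs⟩ := GA2 p
  obtain ⟨a, b, ha, hb, hab⟩ := GA2 (i p)
  have hps : i p ≤ i s := hanti _ _ hs
  have hpb : p ≤ i b := by
    have h := hanti _ _ hb
    rwa [hinv] at h
  obtain ⟨n, z, y, h0, hl, hzy, -, -, hind, hsm⟩ := GA3 (i s) p r a hrs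
    ⟨p, i s, hr, le_rfl, hrs, hps⟩ (Or.inl hr) (ha.trans hps)
    ⟨i b, i p, hab, hpb, ha, le_rfl⟩ (Or.inr ha)
  have key : ∀ j : Fin (n + 1), z j ≤ p := by
    intro j
    induction j using Fin.induction with
    | zero => rw [h0]; exact hr
    | succ j ih =>
      rcases hind j.succ with h | h
      · exact h
      · exfalso
        obtain ⟨u, v, hyu, hpu, hyv, hpv⟩ := hsm j
        obtain ⟨h1, h2⟩ := hzy j
        have hvp : i v ≤ p := by
          have h := hanti _ _ hpv
          rwa [hinv] at h
        have hvi : y j ≤ i (i v) := by rw [hinv]; exact hyv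
        have hui : y j ≤ i (i u) := by rw [hinv]; exact hyu
        exact hno ⟨z j.castSucc, i v, z j.succ, i u, y j, ih, hvp, h1.trans hvi, h,
          hanti _ _ hpu, h2.trans hui, h1, h2, hanti _ _ hyv, hanti _ _ hyu⟩
  have hap := key (Fin.last n)
  rw [hl] at hap
  exact GA0 p ⟨a, hap, ha⟩
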